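/- arXiv:2209.04807 — 9 statements merged into one kernel-verified Lean document; each statement's English description precedes it below -/
import Mathlib

section
/- Let w ∈ K^n be a non-zero vector with f(A)w = 0, let d = deg f, and let α_1, …, α_d ∈ ℂ be the (distinct) roots of f in ℂ. Then the d vectors g_{α_1}(A)w, g_{α_2}(A)w, …, g_{α_d}(A)w are linearly independent over ℂ. -/
open Polynomial Matrix

/-- The complex matrix obtained from a matrix over a subfield `K` of `ℂ`. -/
noncomputable def matC (K : Subfield ℂ) {n : ℕ} (A : Matrix (Fin n) (Fin n) K) :
    Matrix (Fin n) (Fin n) ℂ :=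
  A.map (fun x => (x : ℂ))

/-- The complex vector obtained from a vector over a subfield `K` of `ℂ`. -/
noncomputable def vecC (K : Subfield ℂ) {n : ℕ} (w : Fin n → K) : Fin n → ℂ :=
  fun i => (w i : ℂ)

/-- For a root `α` of `f`, the quotient `g_α(x) = f(x)/(x - α)` in `ℂ[x]`,
i.e. the paper's `ψ_f(x, α)`. -/
noncomputable def galpha (K : Subfield ℂ) (f : Polynomial K) (α : ℂ) : Polynomial ℂ :=
  (f.map K.subtype) / (X - C α)

/-- Let `f` be irreducible over `K` with `f(A)w = 0` and `w ≠ 0`. Then no polynomial `g` over an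
extension `L` of `K` having smaller degree and some coefficient equal to `1` kills `w`; the vector
`g(A)w` is written out coordinatewise. -/
theorem exists_sum_coeff_pow_mulVec_ne_zero {K L ι : Type*} [Field K] [Field L] [Algebra K L]
    [Fintype ι] [DecidableEq ι] {A : Matrix ι ι K} {f : K[X]} (hirr : Irreducible f)
    {w : ι → K} (hw : w ≠ 0) (hker : (aeval A f).mulVec w = 0)
    {g : L[X]} (hdeg : g.natDegree < f.natDegree) {k : ℕ} (hk : g.coeff k = 1) :
    ∃ j, ∑ i ∈ Finset.range f.natDegree, g.coeff i * algebraMap K L ((A ^ i).mulVec w j) ≠ 0 := by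
  by_contra! hzero
  obtain ⟨φ, hφ⟩ := (Algebra.linearMap K L).exists_leftInverse_of_injective
    (LinearMap.ker_eq_bot.mpr (algebraMap K L).injective)
  have hφ_one : φ 1 = 1 := by simpa using LinearMap.congr_fun hφ 1
  set h : K[X] := ∑ i ∈ Finset.range f.natDegree, monomial i (φ (g.coeff i)) with hh
  have hk_lt : k < f.natDegree :=
    (le_natDegree_of_ne_zero (by simp [hk])).trans_lt hdeg
  have h_ne : h ≠ 0 := fun h0 => by
    have hc : h.coeff k = 1 := by
      simp [hh, finsetSum_coeff, coeff_monomial, hk_lt, hk, hφ_one]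
    simp [h0] at hc
  have h_deg : h.degree < f.degree := by
    rw [degree_eq_natDegree hirr.ne_zero]
    refine (degree_sum_le _ _).trans_lt ((Finset.sup_lt_iff (WithBot.bot_lt_coe _)).mpr ?_)
    intro i hi
    exact (degree_monomial_le _ _).trans_lt (by exact_mod_cast Finset.mem_range.mp hi)
  have h_ker : (aeval A h).mulVec w = 0 := by
    funext j
    have hj := congrArg φ (hzero j)
    simp only [map_sum, map_zero, mul_comm (g.coeff _), ← Algebra.smul_def, map_smul] at hj
    simpa [hh, aeval_monomial, Matrix.sum_mulVec, ← Algebra.smul_def, Matrix.smul_mulVec,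
      mul_comm] using hj
  obtain ⟨a, b, hab⟩ := (hirr.coprime_iff_not_dvd (n := h)).mpr
    fun hd => h_ne (eq_zero_of_dvd_of_degree_lt hd h_deg)
  apply hw
  calc w = (aeval A (a * f + b * h)).mulVec w := by simp [hab]
    _ = 0 := by
      simp [Matrix.add_mulVec, ← Matrix.mulVec_mulVec, hker, h_ker]

theorem matC_pow_mulVec_vecC (K : Subfield ℂ) {n : ℕ} (A : Matrix (Fin n) (Fin n) K)
    (w : Fin n → K) (i : ℕ) :
    (matC K A ^ i).mulVec (vecC K w) = vecC K ((A ^ i).mulVec w) := by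
  have hpow : matC K A ^ i = (A ^ i).map K.subtype := (Matrix.map_pow A K.subtype i).symm
  funext j
  rw [hpow]
  exact (RingHom.map_mulVec K.subtype (A ^ i) w j).symm

theorem aeval_matC_mulVec_vecC (K : Subfield ℂ) {n : ℕ} (A : Matrix (Fin n) (Fin n) K)
    (w : Fin n → K) {g : ℂ[X]} {d : ℕ} (hd : g.natDegree < d) :
    (aeval (matC K A) g).mulVec (vecC K w) =
      ∑ i ∈ Finset.range d, g.coeff i • vecC K ((A ^ i).mulVec w) := by
  simp [aeval_eq_sum_range' hd, Matrix.sum_mulVec, Matrix.smul_mulVec, matC_pow_mulVec_vecC]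

theorem aeval_matC_map_mulVec_vecC (K : Subfield ℂ) {n : ℕ} (A : Matrix (Fin n) (Fin n) K)
    (w : Fin n → K) (f : K[X]) :
    (aeval (matC K A) (f.map K.subtype)).mulVec (vecC K w) =
      vecC K ((aeval A f).mulVec w) := by
  have hd := Nat.lt_succ_self f.natDegree
  rw [aeval_matC_mulVec_vecC K A w (natDegree_map_le.trans_lt hd), aeval_eq_sum_range' hd]
  funext j
  simp [vecC, Matrix.sum_mulVec, Matrix.smul_mulVec]

theorem stmt1 (K : Subfield ℂ) (n : ℕ) (hn : 1 ≤ n)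
    (A : Matrix (Fin n) (Fin n) K) (f : Polynomial K)
    (hmonic : f.Monic) (hirr : Irreducible f) (hdvd : f ∣ A.charpoly)
    (w : Fin n → K) (hw : w ≠ 0)
    (hker : (Polynomial.aeval A f).mulVec w = 0) :
    LinearIndependent ℂ
      (fun α : {x : ℂ // (f.map K.subtype).IsRoot x} =>
        (Polynomial.aeval (matC K A) (galpha K f α.val)).mulVec (vecC K w)) := by
  refine Module.End.eigenvectors_linearIndependent' (Matrix.toLin' (matC K A)) Subtype.val
    Subtype.val_injective _ fun α => ?_
  have hmul : (X - C α.val) * galpha K f α.val = f.map K.subtype :=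
    mul_div_eq_iff_isRoot.mpr α.2
  have hg : (galpha K f α.val).Monic :=
    (monic_X_sub_C α.val).of_mul_monic_left
      (by rw [hmul]; exact hmonic.map K.subtype)
  have hdeg : (galpha K f α.val).natDegree < f.natDegree := by
    have := congrArg natDegree hmul
    rw [(monic_X_sub_C α.val).natDegree_mul hg, natDegree_X_sub_C, natDegree_map] at this
    omega
  refine ⟨Module.End.mem_eigenspace_iff.mpr ?_, fun h0 => ?_⟩
  · have h := aeval_matC_map_mulVec_vecC K A w f
    rw [hker, ← hmul, map_mul, ← Matrix.mulVec_mulVec] at h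
    have hzero : vecC K (0 : Fin n → K) = 0 := by
      funext j
      simp [vecC]
    rw [hzero, map_sub, aeval_X, aeval_C, Matrix.sub_mulVec, sub_eq_zero,
      Algebra.algebraMap_eq_smul_one, Matrix.smul_mulVec, Matrix.one_mulVec] at h
    rwa [Matrix.toLin'_apply]
  · obtain ⟨j, hj⟩ := exists_sum_coeff_pow_mulVec_ne_zero hirr hw hker hdeg hg.coeff_natDegree
    rw [aeval_matC_mulVec_vecC K A w hdeg] at h0
    apply hj
    have h0j := congrFun h0 j
    simp only [Finset.sum_apply, Pi.smul_apply, smul_eq_mul, Pi.zero_apply] at h0j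
    exact h0j
end

section
/- Let u ∈ K^n satisfy f(A)^ℓ u = 0 and f(A)^{ℓ−1} u ≠ 0 for some ℓ ≥ 1, and let α ∈ ℂ be a root of f. Then for every k with 1 ≤ k ≤ ℓ, (A − αI)^{k−1}·p^{(k)}(α,u) ≠ 0 and (A − αI)^{k}·p^{(k)}(α,u) = 0; that is, p^{(k)}(α,u) is a generalized eigenvector of rank k of A associated with the eigenvalue α. -/
open Polynomial Matrix

/-- The generalized eigenvector `p⁽ᵏ⁾(α, u) = g_α(A)^k · f(A)^(ℓ-k) · u`, where
`ℓ = rank_f u`. -/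
noncomputable def pvec (K : Subfield ℂ) {n : ℕ} (A : Matrix (Fin n) (Fin n) K)
    (f : Polynomial K) (α : ℂ) (ℓ k : ℕ) (u : Fin n → K) : Fin n → ℂ :=
  ((Polynomial.aeval (matC K A) (galpha K f α)) ^ k *
    (Polynomial.aeval (matC K A) (f.map K.subtype)) ^ (ℓ - k)).mulVec (vecC K u)

/-- A nonzero vector killed by `f(M)`, with `f` irreducible, is not killed by `q(M)` for any
nonzero `q` of smaller degree. -/
theorem aeval_mulVec_ne_zero_of_natDegree_lt {K : Type*} [Field K] {n : ℕ}
    {M : Matrix (Fin n) (Fin n) K} {f q : K[X]} (hirr : Irreducible f) {w : Fin n → K}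
    (hw : w ≠ 0) (hfw : (aeval M f).mulVec w = 0) (hq : q ≠ 0)
    (hdeg : q.natDegree < f.natDegree) : (aeval M q).mulVec w ≠ 0 := by
  intro hqw
  have hndvd : ¬ f ∣ q := fun h => absurd (natDegree_le_of_dvd h hq) (not_le.mpr hdeg)
  obtain ⟨a, b, hab⟩ := (hirr.coprime_iff_not_dvd).2 hndvd
  apply hw
  have h := congrArg (fun p => (aeval M p).mulVec w) hab
  simpa [map_add, map_mul, add_mulVec, ← mulVec_mulVec, hfw, hqw] using h.symm

/-- If `f` is irreducible and `f(M)` kills `w ≠ 0`, some linear functional vanishes on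
`M ^ j w` for `j < deg f - 1` but not on `M ^ (deg f - 1) w`. -/
theorem exists_dual_pow_mulVec {K : Type*} [Field K] {n : ℕ}
    {M : Matrix (Fin n) (Fin n) K} {f : K[X]} (hirr : Irreducible f) {w : Fin n → K}
    (hw : w ≠ 0) (hfw : (aeval M f).mulVec w = 0) :
    ∃ c : Fin n → K, (∀ j < f.natDegree - 1, c ⬝ᵥ (M ^ j).mulVec w = 0) ∧
      c ⬝ᵥ (M ^ (f.natDegree - 1)).mulVec w ≠ 0 := by
  set d := f.natDegree - 1 with hd
  have hpos : 0 < f.natDegree := hirr.natDegree_pos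
  let T : K[X] →ₗ[K] (Fin n → K) :=
    (LinearMap.applyₗ w).comp ((Matrix.toLin' (R := K)).toLinearMap.comp
      (aeval M).toLinearMap)
  have hT : ∀ p, T p = (aeval M p).mulVec w := fun p => by simp [T]
  have hnot : (M ^ d).mulVec w ∉ (degreeLT K d).map T := by
    rintro ⟨p, hp, hpw⟩
    have hlt : p.degree < d := mem_degreeLT.1 hp
    have hmon : (X ^ d - p).Monic := monic_X_pow_sub hlt
    refine aeval_mulVec_ne_zero_of_natDegree_lt hirr hw hfw hmon.ne_zero ?_ ?_
    · have : (X ^ d - p).degree ≤ (d : WithBot ℕ) :=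
        (degree_sub_le _ _).trans (max_le (degree_X_pow_le d) hlt.le)
      have := natDegree_le_of_degree_le this
      omega
    · rw [hT] at hpw
      simp [sub_mulVec, hpw]
  obtain ⟨ψ, hψ, hker⟩ := Submodule.exists_le_ker_of_notMem hnot
  have hψc : ∀ v, (fun i => ψ (fun j => if i = j then 1 else 0)) ⬝ᵥ v = ψ v := fun v => by
    rw [LinearMap.pi_apply_eq_sum_univ ψ v]
    simp [dotProduct, mul_comm]
  refine ⟨fun i => ψ (fun j => if i = j then 1 else 0), fun j hj => ?_, by rwa [hψc]⟩
  rw [hψc]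
  refine hker ⟨X ^ j, mem_degreeLT.2 ?_, by simp [hT]⟩
  rw [degree_X_pow]
  exact_mod_cast hj

theorem matC_eq_mapMatrix (K : Subfield ℂ) {n : ℕ} (A : Matrix (Fin n) (Fin n) K) :
    matC K A = (K.subtype).mapMatrix A := rfl

theorem aeval_matC_map (K : Subfield ℂ) {n : ℕ} (A : Matrix (Fin n) (Fin n) K) (p : K[X]) :
    aeval (matC K A) (p.map K.subtype) = matC K (aeval A p) := by
  rw [aeval_def, eval₂_map, aeval_def, matC_eq_mapMatrix, matC_eq_mapMatrix, hom_eval₂]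
  congr 1
  ext x i j
  by_cases h : i = j <;> simp [algebraMap_matrix_apply, h]

theorem matC_pow (K : Subfield ℂ) {n : ℕ} (A : Matrix (Fin n) (Fin n) K) (m : ℕ) :
    matC K (A ^ m) = matC K A ^ m :=
  map_pow (K.subtype).mapMatrix A m

theorem matC_mulVec_vecC (K : Subfield ℂ) {n : ℕ} (A : Matrix (Fin n) (Fin n) K)
    (w : Fin n → K) : (matC K A).mulVec (vecC K w) = vecC K (A.mulVec w) := by
  ext i
  simp [matC, vecC, mulVec, dotProduct]

theorem vecC_dotProduct_vecC (K : Subfield ℂ) {n : ℕ} (v w : Fin n → K) :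
    vecC K v ⬝ᵥ vecC K w = ((v ⬝ᵥ w : K) : ℂ) := by
  simp [vecC, dotProduct]

theorem X_sub_C_mul_galpha {K : Subfield ℂ} {f : K[X]} {α : ℂ}
    (hα : (f.map K.subtype).IsRoot α) : (X - C α) * galpha K f α = f.map K.subtype :=
  mul_div_eq_iff_isRoot.2 hα

theorem galpha_monic {K : Subfield ℂ} {f : K[X]} {α : ℂ} (hmonic : f.Monic)
    (hα : (f.map K.subtype).IsRoot α) : (galpha K f α).Monic :=
  (monic_X_sub_C α).of_mul_monic_left (X_sub_C_mul_galpha hα ▸ hmonic.map _)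

theorem natDegree_galpha (K : Subfield ℂ) (f : K[X]) (α : ℂ) :
    (galpha K f α).natDegree = f.natDegree - 1 := by
  rw [galpha, ← divByMonic_eq_div _ (monic_X_sub_C α), natDegree_divByMonic _ (monic_X_sub_C α),
    natDegree_X_sub_C, natDegree_map]

theorem aeval_galpha_mulVec_ne_zero {K : Subfield ℂ} {n : ℕ} {A : Matrix (Fin n) (Fin n) K}
    {f : K[X]} (hmonic : f.Monic) (hirr : Irreducible f) {w : Fin n → K} (hw : w ≠ 0)
    (hfw : (aeval A f).mulVec w = 0) {α : ℂ} (hα : (f.map K.subtype).IsRoot α) :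
    (aeval (matC K A) (galpha K f α)).mulVec (vecC K w) ≠ 0 := by
  obtain ⟨c, hc, hc'⟩ := exists_dual_pow_mulVec hirr hw hfw
  intro h
  have hlead : (galpha K f α).coeff (f.natDegree - 1) = 1 := by
    rw [← natDegree_galpha K f α]
    exact galpha_monic hmonic hα
  have hpow : ∀ j, vecC K c ⬝ᵥ (matC K A ^ j).mulVec (vecC K w) =
      ((c ⬝ᵥ (A ^ j).mulVec w : K) : ℂ) := fun j => by
    rw [← matC_pow, matC_mulVec_vecC, vecC_dotProduct_vecC]
  have h0 := congrArg (vecC K c ⬝ᵥ ·) h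
  simp only [dotProduct_zero] at h0
  rw [aeval_eq_sum_range, natDegree_galpha, sum_mulVec, dotProduct_sum,
    Finset.sum_range_succ, Finset.sum_eq_zero, zero_add, smul_mulVec, hlead, one_smul, hpow] at h0
  · exact hc' (by exact_mod_cast h0)
  · intro j hj
    rw [smul_mulVec, dotProduct_smul, hpow, hc j (Finset.mem_range.1 hj)]
    simp

theorem stmt3 (K : Subfield ℂ) (n : ℕ) (hn : 1 ≤ n)
    (A : Matrix (Fin n) (Fin n) K) (f : Polynomial K)
    (hmonic : f.Monic) (hirr : Irreducible f) (hdvd : f ∣ A.charpoly)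
    (u : Fin n → K) (ℓ : ℕ) (hℓ : 1 ≤ ℓ)
    (hker : ((Polynomial.aeval A f) ^ ℓ).mulVec u = 0)
    (hker' : ((Polynomial.aeval A f) ^ (ℓ - 1)).mulVec u ≠ 0)
    (α : ℂ) (hα : (f.map K.subtype).IsRoot α) :
    ∀ k : ℕ, 1 ≤ k → k ≤ ℓ →
      ((matC K A - α • (1 : Matrix (Fin n) (Fin n) ℂ)) ^ (k - 1)).mulVec
          (pvec K A f α ℓ k u) ≠ 0 ∧
        ((matC K A - α • (1 : Matrix (Fin n) (Fin n) ℂ)) ^ k).mulVec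
          (pvec K A f α ℓ k u) = 0 := by
  intro k hk hkl
  have hvec : ∀ m, (aeval (matC K A) (f.map K.subtype) ^ m).mulVec (vecC K u) =
      vecC K ((aeval A f ^ m).mulVec u) := fun m => by
    rw [aeval_matC_map, ← matC_pow, matC_mulVec_vecC]
  have hsub : matC K A - α • (1 : Matrix (Fin n) (Fin n) ℂ) =
      aeval (matC K A) (X - C α) := by
    simp [Algebra.algebraMap_eq_smul_one]
  constructor
  · have hpoly : (X - C α) ^ (k - 1) * (galpha K f α ^ k * f.map K.subtype ^ (ℓ - k)) =
        galpha K f α * f.map K.subtype ^ (ℓ - 1) := by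
      obtain ⟨m, rfl⟩ := Nat.exists_eq_add_of_le' hk
      obtain ⟨j, rfl⟩ := Nat.exists_eq_add_of_le hkl
      rw [← X_sub_C_mul_galpha hα, Nat.add_sub_cancel_left, Nat.add_sub_cancel,
        show m + 1 + j - 1 = m + j by omega]
      generalize (X - C α : ℂ[X]) = q
      ring
    rw [pvec, mulVec_mulVec, hsub, ← map_pow, ← map_pow, ← map_pow, ← map_mul, ← map_mul, hpoly,
      map_mul, map_pow, ← mulVec_mulVec, hvec]
    refine aeval_galpha_mulVec_ne_zero hmonic hirr hker' ?_ hα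
    rw [mulVec_mulVec, ← pow_succ', Nat.sub_add_cancel hℓ, hker]
  · have hpoly : (X - C α) ^ k * (galpha K f α ^ k * f.map K.subtype ^ (ℓ - k)) =
        f.map K.subtype ^ ℓ := by
      rw [← mul_assoc, ← mul_pow, X_sub_C_mul_galpha hα, ← pow_add, Nat.add_sub_cancel' hkl]
    rw [pvec, mulVec_mulVec, hsub, ← map_pow, ← map_pow, ← map_pow, ← map_mul, ← map_mul, hpoly,
      map_pow, hvec, hker]
    ext i
    simp [vecC]
end

section
/- Let ℓ̄ be the multiplicity of f in the minimal polynomial of A. Then there exists a finite subset B of ker f(A)^ℓ̄ ⊆ K^n such that the family of Krylov subspaces {L_A(b) : b ∈ B} is independent (each L_A(b) intersects the sum of the others only in 0) and Σ_{b∈B} L_A(b) = ker f(A)^ℓ̄; that is, ker f(A)^ℓ̄ admits a Jordan–Krylov basis with respect to A. -/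
open Polynomial Matrix
set_option synthInstance.maxHeartbeats 1000000
set_option maxHeartbeats 1000000

/-- The Krylov subspace `L_A(u) = Span_K {A^k u : k ≥ 0}`. -/
noncomputable def krylov (K : Subfield ℂ) {n : ℕ} (A : Matrix (Fin n) (Fin n) K)
    (u : Fin n → K) : Submodule K (Fin n → K) :=
  Submodule.span K (Set.range fun k : ℕ => (A ^ k).mulVec u)

/-- The canonical summands of a direct sum of modules are independent. -/
theorem DirectSum.iSupIndep_range_lof {R ι : Type*} [Ring R] [DecidableEq ι] (Q : ι → Type*)
    [∀ i, AddCommGroup (Q i)] [∀ i, Module R (Q i)] :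
    iSupIndep fun i => LinearMap.range (DirectSum.lof R ι Q i) := by
  intro i
  rw [Submodule.disjoint_def]
  rintro _ ⟨y, rfl⟩ hx
  have hle : (⨆ (j) (_ : j ≠ i), LinearMap.range (DirectSum.lof R ι Q j)) ≤
      LinearMap.ker (DirectSum.component R ι Q i) := by
    refine iSup₂_le fun j hj => ?_
    rintro _ ⟨z, rfl⟩
    rw [LinearMap.mem_ker, DirectSum.component.of, dif_neg hj]
  have h := LinearMap.mem_ker.mp (hle hx)
  rw [DirectSum.component.lof_self] at h
  rw [h, map_zero]

/-- The canonical summands of a direct sum of modules span it. -/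
theorem DirectSum.iSup_range_lof {R ι : Type*} [Ring R] [DecidableEq ι] (Q : ι → Type*)
    [∀ i, AddCommGroup (Q i)] [∀ i, Module R (Q i)] :
    ⨆ i, LinearMap.range (DirectSum.lof R ι Q i) = ⊤ := by
  refine eq_top_iff.mpr fun x _ => ?_
  induction x using DirectSum.induction_on with
  | zero => exact zero_mem _
  | of i y => exact Submodule.mem_iSup_of_mem i ⟨y, rfl⟩
  | add x y hx hy => exact add_mem (hx trivial) (hy trivial)

/-- Over a principal ideal domain, the `p ^ l`-torsion of a finitely generated module, with `p`
irreducible, is an independent sum of finitely many cyclic submodules. -/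
theorem Submodule.exists_iSupIndep_span_singleton_torsionBy_pow {R M : Type*} [CommRing R]
    [IsDomain R] [IsPrincipalIdealRing R] [AddCommGroup M] [Module R M] [Module.Finite R M]
    {p : R} (hp : Irreducible p) (l : ℕ) :
    ∃ (d : ℕ) (b : Fin d → M), iSupIndep (fun i => Submodule.span R {b i}) ∧
      ⨆ i, Submodule.span R {b i} = Submodule.torsionBy R M (p ^ l) := by
  classical
  have htors : Module.IsTorsion' (Submodule.torsionBy R M (p ^ l)) (Submonoid.powers p) :=
    fun {x} => ⟨⟨p ^ l, l, rfl⟩, Submodule.smul_torsionBy (p ^ l) x⟩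
  obtain ⟨d, k, ⟨e⟩⟩ := Module.torsion_by_prime_power_decomposition hp htors
  let Q : Fin d → Type _ := fun i => R ⧸ Submodule.span R {p ^ k i}
  let g : DirectSum (Fin d) Q →ₗ[R] M :=
    (Submodule.torsionBy R M (p ^ l)).subtype ∘ₗ e.symm.toLinearMap
  have hg : Function.Injective g := Subtype.val_injective.comp e.symm.injective
  have hrange : LinearMap.range g = Submodule.torsionBy R M (p ^ l) := by
    rw [LinearMap.range_comp, LinearEquiv.range, Submodule.map_top, Submodule.range_subtype]
  have hspan (i : Fin d) : Submodule.span R {g (DirectSum.lof R (Fin d) Q i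
      (Submodule.Quotient.mk 1))} = (LinearMap.range (DirectSum.lof R (Fin d) Q i)).map g := by
    have htop : Submodule.span R {(Submodule.Quotient.mk 1 : Q i)} = ⊤ := by
      refine eq_top_iff.mpr fun x _ => ?_
      obtain ⟨r, rfl⟩ := Submodule.Quotient.mk_surjective _ x
      refine Submodule.mem_span_singleton.mpr ⟨r, ?_⟩
      rw [← Submodule.Quotient.mk_smul, smul_eq_mul, mul_one]
    rw [← Submodule.map_top, ← htop, Submodule.map_span, Submodule.map_span, Set.image_singleton,
      Set.image_singleton]
  refine ⟨d, fun i => g (DirectSum.lof R (Fin d) Q i (Submodule.Quotient.mk 1)), ?_, ?_⟩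
  · simp only [hspan]
    exact LinearMap.iSupIndep_map g hg (DirectSum.iSupIndep_range_lof Q)
  · simp only [hspan]
    rw [← Submodule.map_iSup, DirectSum.iSup_range_lof, Submodule.map_top, hrange]

/-- Restriction of scalars preserves independence of submodules. -/
theorem Submodule.iSupIndep_restrictScalars (S : Type*) {R M ι : Type*} [Semiring S] [Semiring R]
    [AddCommMonoid M] [Module R M] [Module S M] [SMul S R] [IsScalarTower S R M]
    {p : ι → Submodule R M} (hp : iSupIndep p) :
    iSupIndep fun i => (p i).restrictScalars S := by
  intro i
  have h := hp i
  rw [Submodule.disjoint_def] at h ⊢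
  intro x hx hx'
  refine h x hx ?_
  simpa only [← Submodule.restrictScalars_iSup, Submodule.restrictScalars_mem] using hx'

theorem mem_krylov_iff {K : Subfield ℂ} {n : ℕ} {A : Matrix (Fin n) (Fin n) K}
    {u x : Fin n → K} : x ∈ krylov K A u ↔ ∃ q : K[X], (aeval A q).mulVec u = x := by
  constructor
  · intro hx
    induction hx using Submodule.span_induction with
    | mem x hx =>
      obtain ⟨k, rfl⟩ := hx
      exact ⟨X ^ k, by simp⟩
    | zero => exact ⟨0, by simp⟩
    | add x y _ _ hx hy =>
      obtain ⟨⟨q, rfl⟩, ⟨r, rfl⟩⟩ := And.intro hx hy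
      exact ⟨q + r, by rw [map_add, Matrix.add_mulVec]⟩
    | smul c x _ hx =>
      obtain ⟨q, rfl⟩ := hx
      exact ⟨c • q, by rw [map_smul, Matrix.smul_mulVec]⟩
  · rintro ⟨q, rfl⟩
    induction q using Polynomial.induction_on' with
    | add q r hq hr =>
      rw [map_add, Matrix.add_mulVec]
      exact add_mem hq hr
    | monomial k c =>
      rw [← Polynomial.smul_X_eq_monomial, map_smul, map_pow, aeval_X, Matrix.smul_mulVec]
      exact Submodule.smul_mem _ c (Submodule.subset_span ⟨k, rfl⟩)

/-- For irreducible `f`, the kernel of `f(A) ^ l` is an independent sum of finitely many Krylov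
subspaces. -/
theorem exists_iSupIndep_krylov_eq_ker {K : Subfield ℂ} {n : ℕ} (A : Matrix (Fin n) (Fin n) K)
    {f : K[X]} (hf : Irreducible f) (l : ℕ) :
    ∃ (d : ℕ) (b : Fin d → Fin n → K), iSupIndep (fun i => krylov K A (b i)) ∧
      ⨆ i, krylov K A (b i) = LinearMap.ker ((aeval A f ^ l).mulVecLin) := by
  let φ : K[X] →ₐ[K] Module.End K (Fin n → K) :=
    (Matrix.toLinAlgEquiv' : Matrix (Fin n) (Fin n) K ≃ₐ[K] _).toAlgHom.comp (aeval A)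
  let : Module K[X] (Fin n → K) := Module.compHom _ φ.toRingHom
  have hsmul (q : K[X]) (x : Fin n → K) : q • x = (aeval A q).mulVec x := rfl
  have : IsScalarTower K K[X] (Fin n → K) :=
    ⟨fun c q x => by rw [hsmul, hsmul, map_smul, Matrix.smul_mulVec]⟩
  have : Module.Finite K[X] (Fin n → K) := Module.Finite.of_restrictScalars_finite K _ _
  obtain ⟨d, b, hind, hsup⟩ :=
    Submodule.exists_iSupIndep_span_singleton_torsionBy_pow (M := Fin n → K) hf l
  have hkrylov (i : Fin d) :
      krylov K A (b i) = (Submodule.span K[X] {b i}).restrictScalars K := by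
    ext x
    rw [mem_krylov_iff, Submodule.restrictScalars_mem, Submodule.mem_span_singleton]
    simp only [hsmul]
  refine ⟨d, b, ?_, ?_⟩
  · simp only [hkrylov]
    exact Submodule.iSupIndep_restrictScalars K hind
  · simp only [hkrylov]
    rw [← Submodule.restrictScalars_iSup, hsup]
    ext x
    rw [Submodule.restrictScalars_mem, Submodule.mem_torsionBy_iff, hsmul, map_pow,
      LinearMap.mem_ker, Matrix.mulVecLin_apply]

theorem stmt5 (K : Subfield ℂ) (n : ℕ) (hn : 1 ≤ n)
    (A : Matrix (Fin n) (Fin n) K) (f : Polynomial K)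
    (hmonic : f.Monic) (hirr : Irreducible f) (hdvd : f ∣ A.charpoly)
    (lbar : ℕ) (hl1 : f ^ lbar ∣ minpoly K A) (hl2 : ¬ f ^ (lbar + 1) ∣ minpoly K A) :
    ∃ B : Finset (Fin n → K),
      (∀ b ∈ B, ((Polynomial.aeval A f) ^ lbar).mulVec b = 0) ∧
      iSupIndep (fun b : B => krylov K A b.val) ∧
      (⨆ b ∈ B, krylov K A b) =
        LinearMap.ker (((Polynomial.aeval A f) ^ lbar).mulVecLin) := by
  classical
  obtain ⟨d, b, hind, hsup⟩ := exists_iSupIndep_krylov_eq_ker A hirr lbar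
  refine ⟨Finset.univ.image b, fun v hv => ?_, ?_, ?_⟩
  · obtain ⟨i, -, rfl⟩ := Finset.mem_image.mp hv
    have hmem : b i ∈ krylov K A (b i) := mem_krylov_iff.mpr ⟨1, by simp⟩
    exact LinearMap.mem_ker.mp (hsup.le (Submodule.mem_iSup_of_mem i hmem))
  · choose s hs using fun v : Finset.univ.image b => Finset.mem_image.mp v.2
    have hinj : Function.Injective s := fun v w hvw =>
      Subtype.ext (by rw [← (hs v).2, ← (hs w).2, hvw])
    have h := hind.comp hinj
    simpa only [Function.comp_def, (hs _).2] using h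
  · rw [← hsup, Finset.iSup_finset_image]
    simp only [Finset.mem_univ, iSup_pos]
end

section
/- Let ℓ̄ be the multiplicity of f in the minimal polynomial of A, and let B and B' be two Jordan–Krylov bases of ker f(A)^ℓ̄ with respect to A. Then for every ℓ ≥ 1, the number of elements b ∈ B with rank_f b = ℓ equals the number of elements b' ∈ B' with rank_f b' = ℓ. -/
open Polynomial Matrix
set_option synthInstance.maxHeartbeats 1000000
set_option maxHeartbeats 1000000

/-- `B` is a Jordan–Krylov basis of `ker f(A)^ℓ̄` with respect to `A`:
it is a finite subset of `ker f(A)^ℓ̄`, the family of Krylov subspaces of its elements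
is independent, and their sum is `ker f(A)^ℓ̄`. -/
def IsJordanKrylovBasis (K : Subfield ℂ) {n : ℕ} (A : Matrix (Fin n) (Fin n) K)
    (f : Polynomial K) (lbar : ℕ) (B : Finset (Fin n → K)) : Prop :=
  (∀ b ∈ B, ((Polynomial.aeval A f) ^ lbar).mulVec b = 0) ∧
  iSupIndep (fun b : B => krylov K A b.val) ∧
  (⨆ b ∈ B, krylov K A b) = LinearMap.ker (((Polynomial.aeval A f) ^ lbar).mulVecLin)

theorem finrank_iSup_of_iSupIndep {k V ι : Type*} [Field k] [AddCommGroup V] [Module k V]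
    [FiniteDimensional k V] [Fintype ι] {p : ι → Submodule k V} (hp : iSupIndep p) :
    Module.finrank k ↥(⨆ i, p i) = ∑ i, Module.finrank k (p i) := by
  classical
  rw [Submodule.iSup_eq_range_dfinsupp_lsum,
    LinearMap.finrank_range_of_inj hp.dfinsupp_lsum_injective]
  exact Module.finrank_directSum k fun i => p i

/-- The map `p ↦ p(A) v`, whose range is the Krylov subspace of `v`. -/
noncomputable def krylovMap (K : Subfield ℂ) {n : ℕ} (A : Matrix (Fin n) (Fin n) K)
    (v : Fin n → K) : K[X] →ₗ[K] (Fin n → K) :=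
  (Matrix.mulVecBilin K K).flip v ∘ₗ (aeval A).toLinearMap

theorem krylovMap_apply (K : Subfield ℂ) {n : ℕ} (A : Matrix (Fin n) (Fin n) K)
    (v : Fin n → K) (p : K[X]) : krylovMap K A v p = (aeval A p).mulVec v := rfl

theorem range_krylovMap (K : Subfield ℂ) {n : ℕ} (A : Matrix (Fin n) (Fin n) K)
    (v : Fin n → K) : LinearMap.range (krylovMap K A v) = krylov K A v := by
  rw [LinearMap.range_eq_map, ← (Polynomial.basisMonomials K).span_eq, Submodule.map_span,
    ← Set.range_comp, krylov]
  congr 2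
  ext k : 1
  simp [krylovMap_apply, ← X_pow_eq_monomial]

theorem krylovMap_mul (K : Subfield ℂ) {n : ℕ} (A : Matrix (Fin n) (Fin n) K)
    (v : Fin n → K) (p q : K[X]) :
    krylovMap K A v (p * q) = (aeval A p).mulVec (krylovMap K A v q) := by
  simp [krylovMap_apply, Matrix.mulVec_mulVec]

theorem krylovMap_eq_zero_of_dvd {K : Subfield ℂ} {n : ℕ} {A : Matrix (Fin n) (Fin n) K}
    {v : Fin n → K} {p q : K[X]} (h : p ∣ q) (hp : krylovMap K A v p = 0) :
    krylovMap K A v q = 0 := by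
  obtain ⟨r, rfl⟩ := h
  rw [mul_comm, krylovMap_mul, hp, Matrix.mulVec_zero]

theorem krylovMap_eq_zero_iff_dvd {K : Subfield ℂ} {n : ℕ} {A : Matrix (Fin n) (Fin n) K}
    {v : Fin n → K} {f : K[X]} (hf : Irreducible f) {m : ℕ}
    (h : ∀ j, krylovMap K A v (f ^ j) = 0 ↔ m ≤ j) (p : K[X]) :
    krylovMap K A v p = 0 ↔ f ^ m ∣ p := by
  classical
  have hm := (h m).2 le_rfl
  refine ⟨fun hp => ?_, fun hd => krylovMap_eq_zero_of_dvd hd hm⟩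
  have hg : krylovMap K A v (EuclideanDomain.gcd p (f ^ m)) = 0 := by
    rw [EuclideanDomain.gcd_eq_gcd_ab, map_add,
      krylovMap_eq_zero_of_dvd (dvd_mul_right _ _) hp,
      krylovMap_eq_zero_of_dvd (dvd_mul_right _ _) hm, add_zero]
  obtain ⟨j, -, hj⟩ := (dvd_prime_pow hf.prime m).1 (EuclideanDomain.gcd_dvd_right p (f ^ m))
  exact (pow_dvd_pow f ((h j).1 (krylovMap_eq_zero_of_dvd hj.dvd hg))).trans
    (hj.symm.dvd.trans (EuclideanDomain.gcd_dvd_left p (f ^ m)))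

theorem finrank_krylov {K : Subfield ℂ} {n : ℕ} {A : Matrix (Fin n) (Fin n) K}
    {v : Fin n → K} {f : K[X]} (hf : Irreducible f) {m : ℕ}
    (h : ∀ j, krylovMap K A v (f ^ j) = 0 ↔ m ≤ j) :
    Module.finrank K (krylov K A v) = m * f.natDegree := by
  have hker : LinearMap.ker (krylovMap K A v) =
      (Ideal.span {f ^ m}).restrictScalars K := by
    ext p
    simp [krylovMap_eq_zero_iff_dvd hf h, Ideal.mem_span_singleton]
  rw [← range_krylovMap, ← (krylovMap K A v).quotKerEquivRange.finrank_eq,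
    (Submodule.quotEquivOfEq _ _ hker).finrank_eq,
    (Submodule.Quotient.restrictScalarsEquiv K (Ideal.span {f ^ m})).finrank_eq,
    finrank_quotient_span_eq_natDegree, natDegree_pow]

theorem krylovMap_aeval_mulVec (K : Subfield ℂ) {n : ℕ} (A : Matrix (Fin n) (Fin n) K)
    (v : Fin n → K) (p q : K[X]) :
    krylovMap K A ((aeval A p).mulVec v) q = krylovMap K A v (p * q) := by
  rw [mul_comm, krylovMap_mul, krylovMap_apply, krylovMap_apply]

theorem map_krylov (K : Subfield ℂ) {n : ℕ} (A : Matrix (Fin n) (Fin n) K)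
    (v : Fin n → K) (p : K[X]) :
    (krylov K A v).map (aeval A p).mulVecLin = krylov K A ((aeval A p).mulVec v) := by
  rw [← range_krylovMap, ← range_krylovMap, ← LinearMap.range_comp]
  congr 1
  refine LinearMap.ext fun q => ?_
  rw [krylovMap_aeval_mulVec, krylovMap_mul]
  rfl

theorem krylov_aeval_mulVec_le (K : Subfield ℂ) {n : ℕ} (A : Matrix (Fin n) (Fin n) K)
    (v : Fin n → K) (p : K[X]) : krylov K A ((aeval A p).mulVec v) ≤ krylov K A v := by
  rw [← range_krylovMap, ← range_krylovMap]
  rintro _ ⟨q, rfl⟩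
  exact ⟨p * q, (krylovMap_aeval_mulVec K A v p q).symm⟩

/-- The nilpotency order of `f(A)` at `v` (with junk value `0` if there is none). -/
noncomputable def rankAt (K : Subfield ℂ) {n : ℕ} (A : Matrix (Fin n) (Fin n) K)
    (f : K[X]) (v : Fin n → K) : ℕ :=
  sInf {j | krylovMap K A v (f ^ j) = 0}

theorem krylovMap_pow_eq_zero_iff {K : Subfield ℂ} {n : ℕ} {A : Matrix (Fin n) (Fin n) K}
    {f : K[X]} {v : Fin n → K} {l : ℕ} (hl : krylovMap K A v (f ^ l) = 0) (j : ℕ) :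
    krylovMap K A v (f ^ j) = 0 ↔ rankAt K A f v ≤ j :=
  ⟨fun h => Nat.sInf_le h, fun h => krylovMap_eq_zero_of_dvd (pow_dvd_pow f h)
    (Nat.sInf_mem (s := {j | krylovMap K A v (f ^ j) = 0}) ⟨l, hl⟩)⟩

theorem IsJordanKrylovBasis.krylovMap_eq_zero {K : Subfield ℂ} {n : ℕ}
    {A : Matrix (Fin n) (Fin n) K} {f : K[X]} {l : ℕ} {B : Finset (Fin n → K)}
    (hB : IsJordanKrylovBasis K A f l B) {b : Fin n → K} (hb : b ∈ B) :
    krylovMap K A b (f ^ l) = 0 := by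
  rw [krylovMap_apply, map_pow]
  exact hB.1 b hb

theorem IsJordanKrylovBasis.finrank_map_ker {K : Subfield ℂ} {n : ℕ}
    {A : Matrix (Fin n) (Fin n) K} {f : K[X]} (hf : Irreducible f) {l : ℕ}
    {B : Finset (Fin n → K)} (hB : IsJordanKrylovBasis K A f l B) (k : ℕ) :
    Module.finrank K ((LinearMap.ker ((aeval A f ^ l).mulVecLin)).map
        (aeval A (f ^ k)).mulVecLin) =
      (∑ b ∈ B, (rankAt K A f b - k)) * f.natDegree := by
  have hmap : (LinearMap.ker ((aeval A f ^ l).mulVecLin)).map (aeval A (f ^ k)).mulVecLin =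
      ⨆ b : B, krylov K A ((aeval A (f ^ k)).mulVec b.val) := by
    rw [← hB.2.2, iSup_subtype', Submodule.map_iSup]
    exact iSup_congr fun b => map_krylov K A b.val (f ^ k)
  have hind := hB.2.1.mono fun b : B => krylov_aeval_mulVec_le K A b.val (f ^ k)
  rw [hmap, finrank_iSup_of_iSupIndep hind, Finset.sum_mul, ← Finset.sum_coe_sort B]
  refine Finset.sum_congr rfl fun b _ => finrank_krylov hf fun j => ?_
  rw [krylovMap_aeval_mulVec, ← pow_add, krylovMap_pow_eq_zero_iff (hB.krylovMap_eq_zero b.2)]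
  omega

theorem IsJordanKrylovBasis.ncard_add {K : Subfield ℂ} {n : ℕ}
    {A : Matrix (Fin n) (Fin n) K} {f : K[X]} {l : ℕ}
    {B : Finset (Fin n → K)} (hB : IsJordanKrylovBasis K A f l B) (j : ℕ) :
    {b ∈ (B : Set (Fin n → K)) |
          ((Polynomial.aeval A f) ^ (j + 1)).mulVec b = 0 ∧
          ((Polynomial.aeval A f) ^ j).mulVec b ≠ 0}.ncard +
        2 * ∑ b ∈ B, (rankAt K A f b - (j + 1)) =
      ∑ b ∈ B, (rankAt K A f b - j) + ∑ b ∈ B, (rankAt K A f b - (j + 2)) := by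
  have hset : {b ∈ (B : Set (Fin n → K)) |
      ((Polynomial.aeval A f) ^ (j + 1)).mulVec b = 0 ∧
      ((Polynomial.aeval A f) ^ j).mulVec b ≠ 0} =
      ((B.filter fun b => rankAt K A f b = j + 1 : Finset (Fin n → K)) : Set (Fin n → K)) := by
    ext b
    simp only [Set.mem_ofPred_eq, Finset.coe_filter, Finset.mem_coe]
    refine and_congr_right fun hb => ?_
    rw [← map_pow, ← map_pow, ← krylovMap_apply, ← krylovMap_apply, Ne,
      krylovMap_pow_eq_zero_iff (hB.krylovMap_eq_zero hb),
      krylovMap_pow_eq_zero_iff (hB.krylovMap_eq_zero hb)]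
    omega
  rw [hset, Set.ncard_coe_finset, Finset.card_filter, Finset.mul_sum, ← Finset.sum_add_distrib,
    ← Finset.sum_add_distrib]
  refine Finset.sum_congr rfl fun b _ => ?_
  split_ifs <;> omega

theorem stmt6 (K : Subfield ℂ) (n : ℕ) (hn : 1 ≤ n)
    (A : Matrix (Fin n) (Fin n) K) (f : Polynomial K)
    (hmonic : f.Monic) (hirr : Irreducible f) (hdvd : f ∣ A.charpoly)
    (lbar : ℕ) (hl1 : f ^ lbar ∣ minpoly K A) (hl2 : ¬ f ^ (lbar + 1) ∣ minpoly K A)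
    (B B' : Finset (Fin n → K))
    (hB : IsJordanKrylovBasis K A f lbar B) (hB' : IsJordanKrylovBasis K A f lbar B') :
    ∀ ℓ : ℕ, 1 ≤ ℓ →
      {b ∈ (B : Set (Fin n → K)) |
          ((Polynomial.aeval A f) ^ ℓ).mulVec b = 0 ∧
          ((Polynomial.aeval A f) ^ (ℓ - 1)).mulVec b ≠ 0}.ncard =
        {b ∈ (B' : Set (Fin n → K)) |
          ((Polynomial.aeval A f) ^ ℓ).mulVec b = 0 ∧
          ((Polynomial.aeval A f) ^ (ℓ - 1)).mulVec b ≠ 0}.ncard := by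
  intro ℓ hℓ
  obtain ⟨j, rfl⟩ := Nat.exists_eq_add_of_le' hℓ
  have key (k : ℕ) : ∑ b ∈ B, (rankAt K A f b - k) = ∑ b ∈ B', (rankAt K A f b - k) :=
    Nat.eq_of_mul_eq_mul_right hirr.natDegree_pos
      ((hB.finrank_map_ker hirr k).symm.trans (hB'.finrank_map_ker hirr k))
  have h := hB.ncard_add j
  have h' := hB'.ncard_add j
  rw [key, key, key] at h
  rw [Nat.add_sub_cancel]
  omega
end

section
/- Suppose the multiplicity m of f in the characteristic polynomial of A equals the multiplicity ℓ̄ of f in the minimal polynomial of A. Then for any vector v ∈ K^n with rank_f v = ℓ̄, one has L_A(v) = ker f(A)^ℓ̄; in particular the single vector v forms a Jordan–Krylov basis of ker f(A)^ℓ̄. -/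
open Polynomial Matrix
set_option synthInstance.maxHeartbeats 1000000
set_option maxHeartbeats 1000000

theorem Polynomial.sub_dvd_aeval_sub_of_commute {R S : Type*} [CommRing R] [Ring S] [Algebra R S]
    {x y : S} (h : Commute x y) (q : R[X]) : x - y ∣ aeval x q - aeval y q := by
  induction q using Polynomial.induction_on' with
  | add p q hp hq =>
    simpa only [map_add, add_sub_add_comm] using dvd_add hp hq
  | monomial k a =>
    obtain ⟨c, hc⟩ := h.sub_dvd_pow_sub_pow k
    refine ⟨a • c, ?_⟩
    rw [aeval_monomial, aeval_monomial, ← mul_sub, hc, ← Algebra.smul_def, mul_smul_comm]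

/-- The characteristic polynomial divides a power of every annihilating polynomial. -/
theorem Matrix.charpoly_dvd_pow_of_aeval_eq_zero {R ι : Type*} [CommRing R] [Fintype ι]
    [DecidableEq ι] (M : Matrix ι ι R) {q : R[X]} (hq : aeval M q = 0) :
    M.charpoly ∣ q ^ Fintype.card ι := by
  have hcomm : Commute (scalar ι (X : R[X])) (M.map C) :=
    scalar_commute _ (fun r => Commute.all _ _) _
  obtain ⟨c, hc⟩ := sub_dvd_aeval_sub_of_commute hcomm q
  have hM : aeval (M.map C) q = 0 := by
    have := aeval_algHom_apply (Algebra.ofId R R[X]).mapMatrix M q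
    rw [hq, map_zero] at this
    exact this
  have hX : aeval (scalar ι (X : R[X])) q = scalar ι q := by
    have := aeval_algHom_apply (scalarAlgHom (R := R) (α := R[X]) ι) X q
    simpa using this
  rw [hM, hX, sub_zero] at hc
  have hdet := congrArg det hc
  rw [det_mul, scalar_apply, det_diagonal, Finset.prod_const, Finset.card_univ] at hdet
  exact ⟨c.det, hdet⟩

theorem LinearMap.charpoly_dvd_pow_of_aeval_eq_zero {R V : Type*} [CommRing R] [Nontrivial R]
    [AddCommGroup V] [Module R V] [Module.Finite R V] [Module.Free R V] (T : Module.End R V)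
    {q : R[X]} (hq : aeval T q = 0) : T.charpoly ∣ q ^ Module.finrank R V := by
  let b := Module.Free.chooseBasis R V
  have hM : aeval (toMatrix b b T) q = 0 := by
    have := aeval_algHom_apply (toMatrixAlgEquiv b) T q
    rw [hq, map_zero] at this
    exact this
  rw [← T.charpoly_toMatrix b, Module.finrank_eq_card_basis b]
  exact Matrix.charpoly_dvd_pow_of_aeval_eq_zero _ hM

theorem LinearMap.charpoly_restrict_dvd_of_isCompl {F V : Type*} [Field F] [AddCommGroup V]
    [Module F V] [FiniteDimensional F V] (T : Module.End F V) {p q : Submodule F V}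
    (h : IsCompl p q) (hp : ∀ x ∈ p, T x ∈ p) (hq : ∀ x ∈ q, T x ∈ q) :
    (T.restrict hp).charpoly ∣ T.charpoly := by
  have : T = (p.prodEquivOfIsCompl q h).conj ((T.restrict hp).prodMap (T.restrict hq)) := by
    ext x
    obtain ⟨⟨a, b⟩, rfl⟩ := (p.prodEquivOfIsCompl q h).surjective x
    simp [LinearEquiv.conj_apply]
  have hchar := congrArg charpoly this
  rw [LinearEquiv.charpoly_conj, charpoly_prodMap] at hchar
  rw [hchar]
  exact dvd_mul_right _ _

theorem LinearMap.coe_aeval_restrict_apply {R V : Type*} [CommRing R] [AddCommGroup V]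
    [Module R V] (T : Module.End R V) {p : Submodule R V} (hp : ∀ x ∈ p, T x ∈ p) (q : R[X])
    (x : p) : (aeval (T.restrict hp) q x : V) = aeval T q x := by
  induction q using Polynomial.induction_on' with
  | add a b ha hb => simp [ha, hb]
  | monomial k a =>
    simp [aeval_monomial, Module.End.pow_restrict k hp]

/-- The kernel of `f(T) ^ m`, where `m` is the multiplicity of `f` in the characteristic
polynomial, has dimension at most `m * deg f`. -/
theorem LinearMap.finrank_ker_aeval_pow_le {F V : Type*} [Field F] [AddCommGroup V]
    [Module F V] [FiniteDimensional F V] (T : Module.End F V) {f : F[X]} (hf : Irreducible f)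
    {m : ℕ} (hm : f ^ m ∣ T.charpoly) (hm' : ¬ f ^ (m + 1) ∣ T.charpoly) :
    Module.finrank F (ker (aeval T (f ^ m))) ≤ m * f.natDegree := by
  obtain ⟨g, hg⟩ := hm
  have hcop : IsCoprime (f ^ m) g := by
    refine IsCoprime.pow_left ((hf.coprime_iff_not_dvd).2 fun hfg => hm' ?_)
    rw [hg, pow_succ]
    exact mul_dvd_mul_left _ hfg
  have hcompl : IsCompl (ker (aeval T (f ^ m))) (ker (aeval T g)) := by
    refine ⟨disjoint_ker_aeval_of_isCoprime T hcop, codisjoint_iff.2 ?_⟩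
    rw [sup_ker_aeval_eq_ker_aeval_mul_of_coprime T hcop, ← hg, T.aeval_self_charpoly, ker_zero]
  have hinv (q : F[X]) : ∀ x ∈ ker (aeval T q), T x ∈ ker (aeval T q) := fun x hx => by
    have hcomm : Commute (aeval T q) T := by simpa using (Commute.all q X).map (aeval T)
    rw [mem_ker] at hx ⊢
    rw [← Module.End.mul_apply, hcomm.eq, Module.End.mul_apply, hx, map_zero]
  have hdvd := T.charpoly_restrict_dvd_of_isCompl hcompl (hinv _) (hinv _)
  have hann : aeval (T.restrict (hinv (f ^ m))) (f ^ m) = 0 := by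
    ext x
    rw [coe_aeval_restrict_apply]
    exact x.2
  have hpow := charpoly_dvd_pow_of_aeval_eq_zero _ hann
  rw [← pow_mul] at hpow
  obtain ⟨k, -, hk⟩ := (dvd_prime_pow hf.prime _).1 hpow
  have hkm : k ≤ m := by
    by_contra! hlt
    exact hm' ((pow_dvd_pow f hlt).trans (hk.symm.dvd.trans hdvd))
  rw [← charpoly_natDegree (T.restrict (hinv (f ^ m))), natDegree_eq_of_degree_eq
    (degree_eq_degree_of_associated hk), natDegree_pow]
  exact Nat.mul_le_mul_right _ hkm

/-- A polynomial annihilating a vector of `f`-rank exactly `m` is divisible by `f ^ m`. -/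
theorem LinearMap.pow_dvd_of_aeval_apply_eq_zero {F V : Type*} [Field F] [AddCommGroup V]
    [Module F V] (T : Module.End F V) {f : F[X]} (hf : Irreducible f) {m : ℕ} {v : V}
    (hv : aeval T (f ^ m) v = 0) (hv' : aeval T (f ^ (m - 1)) v ≠ 0) {p : F[X]}
    (hp : aeval T p v = 0) : f ^ m ∣ p := by
  classical
  have hann : ∀ {a b : F[X]}, a ∣ b → aeval T a v = 0 → aeval T b v = 0 := by
    rintro a _ ⟨c, rfl⟩ h
    rw [mul_comm, map_mul, Module.End.mul_apply, h, map_zero]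
  have hgcd : aeval T (EuclideanDomain.gcd (f ^ m) p) v = 0 := by
    rw [EuclideanDomain.gcd_eq_gcd_ab, map_add, LinearMap.add_apply,
      hann (dvd_mul_right _ _) hv, hann (dvd_mul_right _ _) hp, add_zero]
  obtain ⟨j, hj, hassoc⟩ :=
    (dvd_prime_pow hf.prime _).1 (EuclideanDomain.gcd_dvd_left (f ^ m) p)
  have hjm : j = m := by
    by_contra hne
    exact hv' (hann (hassoc.dvd.trans (pow_dvd_pow f (by omega))) hgcd)
  subst hjm
  exact hassoc.symm.dvd.trans (EuclideanDomain.gcd_dvd_right _ _)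

theorem aeval_mulVec_mem_krylov (K : Subfield ℂ) {n : ℕ} (A : Matrix (Fin n) (Fin n) K)
    (u : Fin n → K) (p : Polynomial K) : (aeval A p).mulVec u ∈ krylov K A u := by
  rw [aeval_eq_sum_range, sum_mulVec]
  refine Submodule.sum_mem _ fun k _ => ?_
  rw [smul_mulVec]
  exact Submodule.smul_mem _ _ (Submodule.subset_span ⟨k, rfl⟩)

theorem stmt11 (K : Subfield ℂ) (n : ℕ) (hn : 1 ≤ n)
    (A : Matrix (Fin n) (Fin n) K) (f : Polynomial K)
    (hmonic : f.Monic) (hirr : Irreducible f) (hdvd : f ∣ A.charpoly)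
    (lbar : ℕ) (hl1 : f ^ lbar ∣ minpoly K A) (hl2 : ¬ f ^ (lbar + 1) ∣ minpoly K A)
    (m : ℕ) (hm1 : f ^ m ∣ A.charpoly) (hm2 : ¬ f ^ (m + 1) ∣ A.charpoly)
    (hml : m = lbar)
    (v : Fin n → K)
    (hv1 : ((Polynomial.aeval A f) ^ lbar).mulVec v = 0)
    (hv2 : ((Polynomial.aeval A f) ^ (lbar - 1)).mulVec v ≠ 0) :
    krylov K A v = LinearMap.ker (((Polynomial.aeval A f) ^ lbar).mulVecLin) := by
  subst hml
  have haeval (p : Polynomial K) (u : Fin n → K) :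
      aeval (toLin' A) p u = (aeval A p).mulVec u := by
    have h := aeval_algHom_apply (toLinAlgEquiv' (R := K) (n := Fin n)) A p
    exact congrArg (· u) h
  have hker : LinearMap.ker ((aeval A f ^ m).mulVecLin) =
      LinearMap.ker (aeval (toLin' A) (f ^ m)) := by
    ext u
    rw [LinearMap.mem_ker, LinearMap.mem_ker, haeval, map_pow, mulVecLin_apply]
  have hchar : (toLin' A).charpoly = A.charpoly := by simp
  refine Submodule.eq_of_le_of_finrank_le (Submodule.span_le.2 ?_) ?_
  · rintro _ ⟨k, rfl⟩
    have hcomm : Commute (aeval A f ^ m) (A ^ k) :=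
      Commute.pow_pow (by simpa using (Commute.all f X).map (aeval A)) m k
    simp only [SetLike.mem_coe, LinearMap.mem_ker, mulVecLin_apply]
    rw [mulVec_mulVec, hcomm.eq, ← mulVec_mulVec, hv1, mulVec_zero]
  · rw [hker]
    refine (LinearMap.finrank_ker_aeval_pow_le (toLin' A) hirr (hchar ▸ hm1)
      (hchar ▸ hm2)).trans ?_
    let φ : degreeLT K (m * f.natDegree) →ₗ[K] krylov K A v :=
      (((LinearMap.applyₗ v).comp (aeval (toLin' A)).toLinearMap).comp
        (degreeLT K (m * f.natDegree)).subtype).codRestrict _ fun p => by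
          simpa [haeval] using aeval_mulVec_mem_krylov K A v p
    have hφ : Function.Injective φ := by
      refine (injective_iff_map_eq_zero φ).2 fun p hp => ?_
      have hp0 : aeval (toLin' A) (p : Polynomial K) v = 0 := congrArg Subtype.val hp
      have hdvd := LinearMap.pow_dvd_of_aeval_apply_eq_zero (toLin' A) hirr
        (by rw [haeval, map_pow, hv1]) (by rwa [haeval, map_pow]) hp0
      refine Subtype.ext (eq_zero_of_dvd_of_degree_lt hdvd ?_)
      rw [degree_eq_natDegree (pow_ne_zero _ hirr.ne_zero), natDegree_pow]
      exact mem_degreeLT.1 p.2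
    have hfin := LinearMap.finrank_le_finrank_of_injective hφ
    rwa [(degreeLTEquiv K (m * f.natDegree)).finrank_eq, Module.finrank_fin_fun] at hfin
end

section
/- Let d = deg f and let u ∈ K^n satisfy f(A)^ℓ u = 0 and f(A)^{ℓ−1} u ≠ 0 for some ℓ ≥ 1. Then the Krylov subspace L_A(u) = Span_K{A^k u : k ≥ 0} has dimension ℓ·d over K. -/
open Polynomial Matrix
set_option synthInstance.maxHeartbeats 1000000
set_option maxHeartbeats 1000000

/-- Evaluation of polynomials at `A`, applied to the vector `u`. -/
noncomputable def aevalMulVec {F : Type*} [Field F] {n : ℕ} (A : Matrix (Fin n) (Fin n) F)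
    (u : Fin n → F) : F[X] →ₗ[F] (Fin n → F) :=
  (Matrix.mulVecBilin F F).flip u ∘ₗ (aeval A).toLinearMap

lemma aevalMulVec_apply {F : Type*} [Field F] {n : ℕ} (A : Matrix (Fin n) (Fin n) F)
    (u : Fin n → F) (p : F[X]) : aevalMulVec A u p = (aeval A p) *ᵥ u := rfl

lemma aevalMulVec_mul {F : Type*} [Field F] {n : ℕ} (A : Matrix (Fin n) (Fin n) F)
    (u : Fin n → F) (p q : F[X]) :
    aevalMulVec A u (p * q) = (aeval A p) *ᵥ aevalMulVec A u q := by
  simp [aevalMulVec_apply, Matrix.mulVec_mulVec]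

lemma aevalMulVec_eq_zero_of_dvd {F : Type*} [Field F] {n : ℕ} {A : Matrix (Fin n) (Fin n) F}
    {u : Fin n → F} {p q : F[X]} (h : p ∣ q) (hp : aevalMulVec A u p = 0) :
    aevalMulVec A u q = 0 := by
  obtain ⟨r, rfl⟩ := h
  rw [mul_comm, aevalMulVec_mul, hp, Matrix.mulVec_zero]

lemma range_aevalMulVec (K : Subfield ℂ) {n : ℕ} (A : Matrix (Fin n) (Fin n) K)
    (u : Fin n → K) : LinearMap.range (aevalMulVec A u) = krylov K A u := by
  rw [LinearMap.range_eq_map, ← (Polynomial.basisMonomials K).span_eq, Submodule.map_span,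
    ← Set.range_comp, krylov]
  congr 2
  ext1 k
  simp [aevalMulVec_apply, aeval_monomial]

lemma pow_dvd_of_aevalMulVec_eq_zero {F : Type*} [Field F] {n : ℕ}
    {A : Matrix (Fin n) (Fin n) F} {u : Fin n → F} {f p : F[X]} {l : ℕ} (hf : Irreducible f)
    (h : aevalMulVec A u (f ^ l) = 0) (h' : aevalMulVec A u (f ^ (l - 1)) ≠ 0)
    (hp : aevalMulVec A u p = 0) : f ^ l ∣ p := by
  classical
  have hg : aevalMulVec A u (EuclideanDomain.gcd p (f ^ l)) = 0 := by
    rw [EuclideanDomain.gcd_eq_gcd_ab, map_add,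
      aevalMulVec_eq_zero_of_dvd (dvd_mul_right _ _) hp,
      aevalMulVec_eq_zero_of_dvd (dvd_mul_right _ _) h, add_zero]
  obtain ⟨k, hk, hassoc⟩ :=
    (dvd_prime_pow hf.prime l).1 (EuclideanDomain.gcd_dvd_right p (f ^ l))
  have hkl : k = l := by
    by_contra hne
    exact h' (aevalMulVec_eq_zero_of_dvd
      (hassoc.dvd.trans (pow_dvd_pow f (by omega : k ≤ l - 1))) hg)
  subst hkl
  exact hassoc.symm.dvd.trans (EuclideanDomain.gcd_dvd_left p _)

theorem stmt14 (K : Subfield ℂ) (n : ℕ) (hn : 1 ≤ n)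
    (A : Matrix (Fin n) (Fin n) K) (f : Polynomial K)
    (hmonic : f.Monic) (hirr : Irreducible f) (hdvd : f ∣ A.charpoly)
    (u : Fin n → K) (ℓ : ℕ) (hℓ : 1 ≤ ℓ)
    (hker : ((Polynomial.aeval A f) ^ ℓ).mulVec u = 0)
    (hker' : ((Polynomial.aeval A f) ^ (ℓ - 1)).mulVec u ≠ 0) :
    Module.finrank K (krylov K A u) = ℓ * f.natDegree := by
  have h : aevalMulVec A u (f ^ ℓ) = 0 := by rwa [aevalMulVec_apply, map_pow]
  have h' : aevalMulVec A u (f ^ (ℓ - 1)) ≠ 0 := by rwa [aevalMulVec_apply, map_pow]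
  have hkernel : LinearMap.ker (aevalMulVec A u) =
      (Ideal.span {f ^ ℓ}).restrictScalars K := by
    ext p
    rw [LinearMap.mem_ker, Submodule.restrictScalars_mem, Ideal.mem_span_singleton]
    exact ⟨pow_dvd_of_aevalMulVec_eq_zero hirr h h', fun hp => aevalMulVec_eq_zero_of_dvd hp h⟩
  rw [← range_aevalMulVec, ← (aevalMulVec A u).quotKerEquivRange.finrank_eq,
    (Submodule.quotEquivOfEq _ _ hkernel).finrank_eq, ← natDegree_pow]
  exact finrank_quotient_span_eq_natDegree
end

section
/- Let d = deg f and let u ∈ K^n satisfy f(A)^ℓ u = 0 and f(A)^{ℓ−1} u ≠ 0 for some ℓ ≥ 1. Let L_{A,d}(u) = Span_K{u, Au, …, A^{d−1}u}. Then L_A(u) = L_{A,d}(u) ⊕ f(A)·L_{A,d}(u) ⊕ ⋯ ⊕ f(A)^{ℓ−1}·L_{A,d}(u); that is, the subspaces f(A)^j L_{A,d}(u) for j = 0, 1, …, ℓ−1 are independent and their sum is the Krylov subspace L_A(u). -/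
open Polynomial Matrix
set_option synthInstance.maxHeartbeats 1000000
set_option maxHeartbeats 1000000

/-- The truncated Krylov subspace `L_{A,d}(u) = Span_K {u, Au, …, A^(d-1) u}`. -/
noncomputable def krylovd (K : Subfield ℂ) {n : ℕ} (A : Matrix (Fin n) (Fin n) K)
    (d : ℕ) (u : Fin n → K) : Submodule K (Fin n → K) :=
  Submodule.span K (Set.range fun k : Fin d => (A ^ (k : ℕ)).mulVec u)

/-- The evaluation map `p ↦ p(A) u`. -/
noncomputable def krylovEval {F : Type*} [Field F] {n : ℕ} (A : Matrix (Fin n) (Fin n) F)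
    (u : Fin n → F) : F[X] →ₗ[F] (Fin n → F) where
  toFun p := (aeval A p).mulVec u
  map_add' p q := by rw [map_add, Matrix.add_mulVec]
  map_smul' c p := by rw [map_smul, Matrix.smul_mulVec, RingHom.id_apply]

section KrylovEval

variable {F : Type*} [Field F] {n : ℕ} (A : Matrix (Fin n) (Fin n) F) (u : Fin n → F)

theorem krylovEval_apply (p : F[X]) : krylovEval A u p = (aeval A p).mulVec u := rfl

theorem krylovEval_mul (p q : F[X]) :
    krylovEval A u (p * q) = (aeval A p).mulVec (krylovEval A u q) := by
  simp only [krylovEval_apply, map_mul, Matrix.mulVec_mulVec]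

theorem krylovEval_X_pow (k : ℕ) : krylovEval A u (X ^ k) = (A ^ k).mulVec u := by
  rw [krylovEval_apply, map_pow, aeval_X]

variable {A u}

theorem krylovEval_eq_zero_of_dvd {p q : F[X]} (hp : krylovEval A u p = 0) (h : p ∣ q) :
    krylovEval A u q = 0 := by
  obtain ⟨r, rfl⟩ := h
  rw [mul_comm, krylovEval_mul, hp, Matrix.mulVec_zero]

/-- If `f ^ ℓ` annihilates `u` but `f ^ (ℓ - 1)` does not, then every polynomial annihilating `u`
is a multiple of `f ^ ℓ`. -/
theorem pow_dvd_of_krylovEval_eq_zero {f : F[X]} (hirr : Irreducible f) {ℓ : ℕ}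
    (hker : krylovEval A u (f ^ ℓ) = 0) (hker' : krylovEval A u (f ^ (ℓ - 1)) ≠ 0)
    {p : F[X]} (hp : krylovEval A u p = 0) : f ^ ℓ ∣ p := by
  classical
  by_contra hndvd
  obtain ⟨i, hi, hassoc⟩ := (dvd_prime_pow hirr.prime ℓ).1 (EuclideanDomain.gcd_dvd_left (f ^ ℓ) p)
  have hne : i ≠ ℓ := by
    rintro rfl
    exact hndvd (hassoc.symm.dvd.trans (EuclideanDomain.gcd_dvd_right _ _))
  have hgcd : krylovEval A u (EuclideanDomain.gcd (f ^ ℓ) p) = 0 := by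
    rw [EuclideanDomain.gcd_eq_gcd_ab, map_add, krylovEval_eq_zero_of_dvd hker (dvd_mul_right _ _),
      krylovEval_eq_zero_of_dvd hp (dvd_mul_right _ _), add_zero]
  exact hker' (krylovEval_eq_zero_of_dvd hgcd
    (hassoc.dvd.trans (pow_dvd_pow f (by omega))))

end KrylovEval

/-- Uniqueness of truncated base-`f` expansions. -/
theorem eq_zero_of_pow_dvd_sum_pow_mul {F : Type*} [Field F] {f : F[X]} (hf : f ≠ 0) {ℓ : ℕ}
    (s : Finset (Fin ℓ)) (r : Fin ℓ → F[X]) (hr : ∀ i ∈ s, (r i).degree < f.degree)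
    (h : f ^ ℓ ∣ ∑ i ∈ s, f ^ (i : ℕ) * r i) : ∀ i ∈ s, r i = 0 := by
  intro i
  induction i using WellFoundedLT.induction with
  | ind i ih =>
    intro hi
    have hrest : f ^ ((i : ℕ) + 1) ∣ ∑ j ∈ s.erase i, f ^ (j : ℕ) * r j := by
      refine Finset.dvd_sum fun j hj => ?_
      obtain ⟨hji, hjs⟩ := Finset.mem_erase.1 hj
      rcases lt_or_gt_of_ne hji with hlt | hgt
      · rw [ih j hlt hjs, mul_zero]
        exact dvd_zero _
      · exact (pow_dvd_pow f (Nat.succ_le_of_lt hgt)).mul_right _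
    have hsum : f ^ ((i : ℕ) + 1) ∣ ∑ j ∈ s, f ^ (j : ℕ) * r j :=
      (pow_dvd_pow f i.isLt).trans h
    rw [← Finset.add_sum_erase s _ hi, dvd_add_left hrest, pow_succ] at hsum
    exact eq_zero_of_dvd_of_degree_lt
      ((mul_dvd_mul_iff_left (pow_ne_zero _ hf)).1 hsum) (hr i hi)

section Krylov

variable {K : Subfield ℂ} {n : ℕ} (A : Matrix (Fin n) (Fin n) K) (u : Fin n → K)

theorem krylov_eq_range : krylov K A u = LinearMap.range (krylovEval A u) := by
  apply le_antisymm
  · refine Submodule.span_le.2 ?_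
    rintro _ ⟨k, rfl⟩
    exact ⟨X ^ k, krylovEval_X_pow A u k⟩
  · rintro _ ⟨p, rfl⟩
    rw [p.as_sum_range_C_mul_X_pow, map_sum]
    refine Submodule.sum_mem _ fun k _ => ?_
    rw [← smul_eq_C_mul, map_smul, krylovEval_X_pow]
    exact Submodule.smul_mem _ _ (Submodule.subset_span ⟨k, rfl⟩)

theorem krylovd_eq_map_degreeLT (d : ℕ) :
    krylovd K A d u = (degreeLT K d).map (krylovEval A u) := by
  classical
  rw [degreeLT_eq_span_X_pow, Submodule.map_span, krylovd]
  congr 1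
  ext v
  simp only [Set.mem_range, Finset.coe_image, Finset.coe_range, Set.mem_image, Set.mem_Iio,
    exists_exists_and_eq_and, krylovEval_X_pow]
  exact ⟨fun ⟨k, hk⟩ => ⟨k, k.isLt, hk⟩, fun ⟨k, hk, h⟩ => ⟨⟨k, hk⟩, h⟩⟩

theorem mem_map_pow_krylovd {f : Polynomial K} (hf : f ≠ 0) (j : ℕ) (v : Fin n → K) :
    v ∈ Submodule.map ((aeval A f ^ j).mulVecLin) (krylovd K A f.natDegree u) ↔
      ∃ r : Polynomial K, r.degree < f.degree ∧ krylovEval A u (f ^ j * r) = v := by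
  simp only [krylovd_eq_map_degreeLT, Submodule.mem_map, mem_degreeLT, exists_exists_and_eq_and,
    Matrix.mulVecLin_apply, krylovEval_mul, map_pow, degree_eq_natDegree hf]

end Krylov

theorem stmt15 (K : Subfield ℂ) (n : ℕ) (hn : 1 ≤ n)
    (A : Matrix (Fin n) (Fin n) K) (f : Polynomial K)
    (hmonic : f.Monic) (hirr : Irreducible f) (hdvd : f ∣ A.charpoly)
    (u : Fin n → K) (ℓ : ℕ) (hℓ : 1 ≤ ℓ)
    (hker : ((Polynomial.aeval A f) ^ ℓ).mulVec u = 0)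
    (hker' : ((Polynomial.aeval A f) ^ (ℓ - 1)).mulVec u ≠ 0) :
    iSupIndep (fun j : Fin ℓ =>
      Submodule.map (((Polynomial.aeval A f) ^ (j : ℕ)).mulVecLin)
        (krylovd K A f.natDegree u)) ∧
    (⨆ j : Fin ℓ,
      Submodule.map (((Polynomial.aeval A f) ^ (j : ℕ)).mulVecLin)
        (krylovd K A f.natDegree u)) = krylov K A u := by
  have hf := hmonic.ne_zero
  have hzero : krylovEval A u (f ^ ℓ) = 0 := by rwa [krylovEval_apply, map_pow]
  have hne : krylovEval A u (f ^ (ℓ - 1)) ≠ 0 := by rwa [krylovEval_apply, map_pow]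
  constructor
  · rw [iSupIndep_iff_finsetSum_eq_zero_imp_eq_zero]
    intro s v hv hsum
    have hex : ∀ i, ∃ r : Polynomial K, i ∈ s →
        r.degree < f.degree ∧ krylovEval A u (f ^ (i : ℕ) * r) = v i := by
      intro i
      by_cases hi : i ∈ s
      · obtain ⟨r, hr⟩ := (mem_map_pow_krylovd A u hf i (v i)).1 (hv i hi)
        exact ⟨r, fun _ => hr⟩
      · exact ⟨0, fun h => absurd h hi⟩
    choose r hr using hex
    have hdvd_sum : f ^ ℓ ∣ ∑ i ∈ s, f ^ (i : ℕ) * r i := by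
      refine pow_dvd_of_krylovEval_eq_zero hirr hzero hne ?_
      rw [map_sum, ← hsum]
      exact Finset.sum_congr rfl fun i hi => (hr i hi).2
    intro i hi
    rw [← (hr i hi).2,
      eq_zero_of_pow_dvd_sum_pow_mul hf s r (fun i hi => (hr i hi).1) hdvd_sum i hi,
      mul_zero, map_zero]
  · rw [krylov_eq_range]
    apply le_antisymm
    · refine iSup_le fun j v hv => ?_
      obtain ⟨r, -, rfl⟩ := (mem_map_pow_krylovd A u hf j v).1 hv
      exact ⟨_, rfl⟩
    · rintro _ ⟨p, rfl⟩
      suffices h : ∀ k ≤ ℓ, ∀ q : Polynomial K, krylovEval A u (f ^ (ℓ - k) * q) ∈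
          ⨆ j : Fin ℓ, Submodule.map (((Polynomial.aeval A f) ^ (j : ℕ)).mulVecLin)
            (krylovd K A f.natDegree u) by
        simpa using h ℓ le_rfl p
      intro k
      induction k with
      | zero =>
        intro _ q
        rw [Nat.sub_zero, krylovEval_eq_zero_of_dvd hzero (dvd_mul_right _ q)]
        exact Submodule.zero_mem _
      | succ k ih =>
        intro hk q
        have hsplit : f ^ (ℓ - (k + 1)) * q =
            f ^ (ℓ - (k + 1)) * (q %ₘ f) + f ^ (ℓ - k) * (q /ₘ f) := by
          rw [show ℓ - k = ℓ - (k + 1) + 1 by omega, pow_succ, mul_assoc, ← mul_add,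
            modByMonic_add_div]
        rw [hsplit, map_add]
        refine Submodule.add_mem _ ?_ (ih (by omega) _)
        exact Submodule.mem_iSup_of_mem (⟨ℓ - (k + 1), by omega⟩ : Fin ℓ)
          ((mem_map_pow_krylovd A u hf _ _).2 ⟨q %ₘ f, degree_modByMonic_lt q hmonic, rfl⟩)
end

section
/- Let d = deg f and let u ∈ K^n satisfy f(A)^ℓ u = 0 and f(A)^{ℓ−1} u ≠ 0 for some ℓ ≥ 1 (i.e. rank_f u = ℓ). Then every non-zero vector v in Span_K{u, Au, …, A^{d−1}u} also satisfies rank_f v = ℓ, i.e. f(A)^ℓ v = 0 and f(A)^{ℓ−1} v ≠ 0. -/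
open Polynomial Matrix
set_option synthInstance.maxHeartbeats 1000000
set_option maxHeartbeats 1000000

/-- Every vector of the truncated Krylov subspace is `p(A) u` for some polynomial `p` of degree
less than `d`. -/
theorem exists_aeval_mulVec_of_mem_krylovd (K : Subfield ℂ) {n : ℕ}
    (A : Matrix (Fin n) (Fin n) K) (d : ℕ) (u : Fin n → K) {v : Fin n → K}
    (hv : v ∈ krylovd K A d u) :
    ∃ p : Polynomial K, p.degree < d ∧ (aeval A p).mulVec u = v := by
  induction hv using Submodule.span_induction with
  | mem x hx =>
    obtain ⟨k, rfl⟩ := hx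
    refine ⟨X ^ (k : ℕ), ?_, by simp⟩
    rw [degree_X_pow]
    exact_mod_cast k.2
  | zero => exact ⟨0, by simp, by simp⟩
  | add x y _ _ hx hy =>
    obtain ⟨p, hp, rfl⟩ := hx
    obtain ⟨q, hq, rfl⟩ := hy
    exact ⟨p + q, (degree_add_le p q).trans_lt (max_lt hp hq), by
      rw [map_add, Matrix.add_mulVec]⟩
  | smul a x _ hx =>
    obtain ⟨p, hp, rfl⟩ := hx
    exact ⟨a • p, (degree_smul_le a p).trans_lt hp, by rw [map_smul, Matrix.smul_mulVec]⟩

theorem stmt16 (K : Subfield ℂ) (n : ℕ) (hn : 1 ≤ n)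
    (A : Matrix (Fin n) (Fin n) K) (f : Polynomial K)
    (hmonic : f.Monic) (hirr : Irreducible f) (hdvd : f ∣ A.charpoly)
    (u : Fin n → K) (ℓ : ℕ) (hℓ : 1 ≤ ℓ)
    (hker : ((Polynomial.aeval A f) ^ ℓ).mulVec u = 0)
    (hker' : ((Polynomial.aeval A f) ^ (ℓ - 1)).mulVec u ≠ 0) :
    ∀ v ∈ krylovd K A f.natDegree u, v ≠ 0 →
      ((Polynomial.aeval A f) ^ ℓ).mulVec v = 0 ∧
      ((Polynomial.aeval A f) ^ (ℓ - 1)).mulVec v ≠ 0 := by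
  intro v hv hv0
  obtain ⟨p, hp, rfl⟩ := exists_aeval_mulVec_of_mem_krylovd K A _ u hv
  have hp0 : p ≠ 0 := by
    rintro rfl
    simp at hv0
  have hcop : IsCoprime f p := by
    refine hirr.coprime_iff_not_dvd.2 fun h => ?_
    have := degree_le_of_dvd h hp0
    rw [degree_eq_natDegree hmonic.ne_zero] at this
    exact absurd hp this.not_gt
  obtain ⟨a, b, hab⟩ := hcop
  obtain ⟨m, rfl⟩ := Nat.exists_eq_add_of_le' hℓ
  simp only [Nat.add_sub_cancel, ← map_pow] at hker hker' ⊢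
  refine ⟨?_, fun h => hker' ?_⟩
  · rw [Matrix.mulVec_mulVec, ← map_mul, mul_comm, map_mul, ← Matrix.mulVec_mulVec, hker,
      Matrix.mulVec_zero]
  · have key : f ^ m = a * f ^ (m + 1) + b * (f ^ m * p) := by
      linear_combination (-f ^ m) * hab
    rw [key, map_add, Matrix.add_mulVec, map_mul, map_mul _ b, map_mul _ (f ^ m),
      ← Matrix.mulVec_mulVec, hker, ← Matrix.mulVec_mulVec, ← Matrix.mulVec_mulVec, h,
      Matrix.mulVec_zero, Matrix.mulVec_zero, add_zero]
end

section
/- Let ℓ̄ be the multiplicity of f in the minimal polynomial of A and suppose b_1, …, b_r ∈ ker f(A)^ℓ̄ are Jordan–Krylov independent with respect to A. Then the subspaces P_A(b_1), P_A(b_2), …, P_A(b_r) of ℂ^n form an independent family (satisfy the direct sum condition), where P_A(b) = Σ_α P_A(α,b) with α ranging over the roots of f in ℂ. -/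
open Polynomial Matrix
set_option synthInstance.maxHeartbeats 1000000
set_option maxHeartbeats 1000000

/-- `rank_f u`: the least `ℓ` with `f(A)^ℓ u = 0`. -/
noncomputable def rankf (K : Subfield ℂ) {n : ℕ} (A : Matrix (Fin n) (Fin n) K)
    (f : Polynomial K) (u : Fin n → K) : ℕ :=
  sInf {ℓ : ℕ | ((Polynomial.aeval A f) ^ ℓ).mulVec u = 0}

/-- The subspace `P_A(α, u) = Span_ℂ {p⁽ᵏ⁾(α, u) : 1 ≤ k ≤ rank_f u}` of `ℂ^n`. -/
noncomputable def Pspace (K : Subfield ℂ) {n : ℕ} (A : Matrix (Fin n) (Fin n) K)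
    (f : Polynomial K) (α : ℂ) (u : Fin n → K) : Submodule ℂ (Fin n → ℂ) :=
  Submodule.span ℂ
    ((fun k => pvec K A f α (rankf K A f u) k u) '' Set.Icc 1 (rankf K A f u))

/-- `P_A(u) = Σ_α P_A(α, u)`, the sum over the roots `α` of `f` in `ℂ`. -/
noncomputable def PspaceTotal (K : Subfield ℂ) {n : ℕ} (A : Matrix (Fin n) (Fin n) K)
    (f : Polynomial K) (u : Fin n → K) : Submodule ℂ (Fin n → ℂ) :=
  ⨆ (α : ℂ) (_ : (f.map K.subtype).IsRoot α), Pspace K A f α u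

/-- The complexification of a `K`-subspace `V` of `K^n`, described as the vectors of `ℂ^n` that
every `K`-linear functional `ℂ → K`, applied coordinatewise, sends into `V`. -/
noncomputable def complexify (K : Subfield ℂ) {n : ℕ} (V : Submodule K (Fin n → K)) :
    Submodule ℂ (Fin n → ℂ) where
  carrier := {w | ∀ φ : ℂ →ₗ[K] K, (fun i => φ (w i)) ∈ V}
  zero_mem' φ := by
    convert V.zero_mem
    simp
  add_mem' {v w} hv hw φ := by
    convert V.add_mem (hv φ) (hw φ)
    simp
  smul_mem' c _ hw φ := hw (φ ∘ₗ LinearMap.mulLeft K c)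

section complexify

variable {K : Subfield ℂ} {n : ℕ} {V W : Submodule K (Fin n → K)}

theorem complexify_mono (h : V ≤ W) : complexify K V ≤ complexify K W :=
  fun _ hw φ => h (hw φ)

theorem disjoint_complexify (h : Disjoint V W) :
    Disjoint (complexify K V) (complexify K W) := by
  rw [Submodule.disjoint_def] at h ⊢
  intro w hV hW
  ext i
  exact (Module.forall_dual_apply_eq_zero_iff K (w i)).1 fun φ =>
    congrFun (h _ (hV φ) (hW φ)) i

theorem vecC_mem_complexify {u : Fin n → K} (hu : u ∈ V) : vecC K u ∈ complexify K V := by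
  intro φ
  convert V.smul_mem (φ 1) hu using 1
  ext i
  have h : ((u i : K) : ℂ) = u i • (1 : ℂ) := by simp [Subfield.smul_def]
  simp only [vecC, h, map_smul, Pi.smul_apply, smul_eq_mul, mul_comm]

theorem matC_mulVec_mem_complexify {A : Matrix (Fin n) (Fin n) K}
    (hA : ∀ v ∈ V, A.mulVec v ∈ V) {w : Fin n → ℂ} (hw : w ∈ complexify K V) :
    (matC K A).mulVec w ∈ complexify K V := by
  intro φ
  convert hA _ (hw φ) using 1
  ext i
  have h (j : Fin n) : (A i j : ℂ) * w j = A i j • w j := rfl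
  simp [Matrix.mulVec, dotProduct, matC, h]

theorem aeval_matC_mulVec_mem_complexify {A : Matrix (Fin n) (Fin n) K}
    (hA : ∀ v ∈ V, A.mulVec v ∈ V) {w : Fin n → ℂ} (hw : w ∈ complexify K V) (p : ℂ[X]) :
    (aeval (matC K A) p).mulVec w ∈ complexify K V := by
  induction p using Polynomial.induction_on' with
  | add p q hp hq =>
    rw [map_add, Matrix.add_mulVec]
    exact add_mem hp hq
  | monomial k a =>
    rw [← C_mul_X_pow_eq_monomial, map_mul, aeval_C, map_pow, aeval_X,
      ← Algebra.smul_def, Matrix.smul_mulVec]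
    refine Submodule.smul_mem _ _ ?_
    induction k with
    | zero => simpa
    | succ k ih =>
      rw [pow_succ', ← Matrix.mulVec_mulVec]
      exact matC_mulVec_mem_complexify hA ih

end complexify

theorem self_mem_krylov (K : Subfield ℂ) {n : ℕ} (A : Matrix (Fin n) (Fin n) K)
    (u : Fin n → K) : u ∈ krylov K A u :=
  Submodule.subset_span ⟨0, by simp⟩

theorem mulVec_mem_krylov (K : Subfield ℂ) {n : ℕ} (A : Matrix (Fin n) (Fin n) K)
    (u : Fin n → K) : ∀ v ∈ krylov K A u, A.mulVec v ∈ krylov K A u := by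
  intro v hv
  have h : krylov K A u ≤ (krylov K A u).comap A.mulVecLin := by
    refine Submodule.span_le.2 ?_
    rintro _ ⟨k, rfl⟩
    exact Submodule.subset_span ⟨k + 1, by simp [pow_succ', Matrix.mulVec_mulVec]⟩
  exact h hv

theorem PspaceTotal_le_complexify_krylov (K : Subfield ℂ) {n : ℕ}
    (A : Matrix (Fin n) (Fin n) K) (f : Polynomial K) (u : Fin n → K) :
    PspaceTotal K A f u ≤ complexify K (krylov K A u) := by
  refine iSup₂_le fun α _ => Submodule.span_le.2 ?_
  rintro _ ⟨k, -, rfl⟩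
  simp only [pvec, ← map_pow, ← map_mul]
  exact aeval_matC_mulVec_mem_complexify (mulVec_mem_krylov K A u)
    (vecC_mem_complexify (self_mem_krylov K A u)) _

theorem stmt19 (K : Subfield ℂ) (n : ℕ) (hn : 1 ≤ n)
    (A : Matrix (Fin n) (Fin n) K) (f : Polynomial K)
    (hmonic : f.Monic) (hirr : Irreducible f) (hdvd : f ∣ A.charpoly)
    (lbar : ℕ) (hl1 : f ^ lbar ∣ minpoly K A) (hl2 : ¬ f ^ (lbar + 1) ∣ minpoly K A)
    (r : ℕ) (b : Fin r → (Fin n → K))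
    (hbker : ∀ i, ((Polynomial.aeval A f) ^ lbar).mulVec (b i) = 0)
    (hbindep : iSupIndep (fun i : Fin r => krylov K A (b i))) :
    iSupIndep (fun i : Fin r => PspaceTotal K A f (b i)) := by
  intro i
  refine (disjoint_complexify (hbindep i)).mono (PspaceTotal_le_complexify_krylov K A f (b i))
    (iSup₂_le fun j hj => ?_)
  exact (PspaceTotal_le_complexify_krylov K A f (b j)).trans
    (complexify_mono (le_iSup₂_of_le j hj le_rfl))
end
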